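/- arXiv:1308.0895 — 5 statements merged into one kernel-verified Lean document; each statement's English description precedes it below -/
import Mathlib

section
/- Let X = G/~ be the quotient of G = E·D by the equivalence relation ~ (a ~ b iff there exists x ∈ E with x⁻¹*a ∈ D and x⁻¹*b ∈ D). The operation [a]*[b] := [a.b] on X is well defined and makes X a group, and the map E → X sending x to its class [x] is a group isomorphism. -/
namespace PartialGroup

variable {Γ : Type*} [Group Γ]

/-- The set `E·D = {x*d : x ∈ E, d ∈ D}`. -/
def prodSet (E : Subgroup Γ) (D : Set Γ) : Set Γ :=
  {g | ∃ x ∈ E, ∃ d ∈ D, g = x * d}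

/-- The relation `a ~ b` iff there exists `x ∈ E` with `x⁻¹*a ∈ D` and `x⁻¹*b ∈ D`,
on `G = E·D`. -/
def simRel (E : Subgroup Γ) (D : Set Γ) (a b : ↥(prodSet E D)) : Prop :=
  ∃ x ∈ E, x⁻¹ * (a : Γ) ∈ D ∧ x⁻¹ * (b : Γ) ∈ D

/-- Supports of decompositions in `E·D̃` are unique when `E ∩ D̃ = {1}`. -/
theorem support_unique {E Dt : Subgroup Γ} (hint : (E : Set Γ) ∩ (Dt : Set Γ) = {1})
    {x y d d' : Γ} (hx : x ∈ E) (hy : y ∈ E) (hd : d ∈ Dt) (hd' : d' ∈ Dt)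
    (h : x * d = y * d') : x = y := by
  have heq : y⁻¹ * x = d' * d⁻¹ := by
    rw [eq_mul_inv_iff_mul_eq, mul_assoc, h, inv_mul_cancel_left]
  have hmem : y⁻¹ * x ∈ (E : Set Γ) ∩ (Dt : Set Γ) :=
    ⟨E.mul_mem (E.inv_mem hy) hx, heq ▸ Dt.mul_mem hd' (Dt.inv_mem hd)⟩
  rw [hint, Set.mem_singleton_iff] at hmem
  exact (inv_mul_eq_one.mp hmem).symm

/-- The class map `E → G/~`, `x ↦ [x]`. -/
def classMap (E : Subgroup Γ) (D : Set Γ) (hD1 : (1 : Γ) ∈ D) (x : E) : Quot (simRel E D) :=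
  Quot.mk _ ⟨(x : Γ), ⟨(x : Γ), x.2, 1, hD1, (mul_one _).symm⟩⟩

theorem mk_eq_classMap {E : Subgroup Γ} {D : Set Γ} (hD1 : (1 : Γ) ∈ D)
    (a : ↥(prodSet E D)) (x : E) (h : (x : Γ)⁻¹ * a ∈ D) :
    Quot.mk _ a = classMap E D hD1 x :=
  Quot.sound ⟨x, x.2, h, by simpa using hD1⟩

theorem classMap_bijective {E Dt : Subgroup Γ} (hint : (E : Set Γ) ∩ (Dt : Set Γ) = {1})
    {D : Set Γ} (hD1 : (1 : Γ) ∈ D) (hDsub : D ⊆ (Dt : Set Γ)) :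
    Function.Bijective (classMap E D hD1) := by
  constructor
  · choose s hs d hd hsd using fun a : ↥(prodSet E D) => a.2
    have huniq : ∀ (a : ↥(prodSet E D)) (x : Γ), x ∈ E → x⁻¹ * (a : Γ) ∈ D → s a = x :=
      fun a x hx h => support_unique hint (hs a) hx (hDsub (hd a)) (hDsub h) (by
        rw [mul_inv_cancel_left, ← hsd])
    have hlift : ∀ a b, simRel E D a b → s a = s b := by
      rintro a b ⟨x, hx, ha, hb⟩
      rw [huniq a x hx ha, huniq b x hx hb]
    intro x y hxy
    have h := congrArg (Quot.lift s hlift) hxy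
    simp only [classMap] at h
    rw [huniq _ x x.2 (by simpa using hD1), huniq _ y y.2 (by simpa using hD1)] at h
    exact Subtype.ext h
  · rintro ⟨a⟩
    obtain ⟨x, hx, d, hd, h⟩ := a.2
    exact ⟨⟨x, hx⟩, (mk_eq_classMap hD1 a ⟨x, hx⟩ (by simpa [h] using hd)).symm⟩

/-- On the quotient `X = G/~` of `G = E·D` by the equivalence relation `~`,
the operation `[a]*[b] := [a.b]` is well defined and makes `X` a group, and the map
`E → X`, `x ↦ [x]`, is a group isomorphism. -/
theorem quotient_group_iso
    (E Dt : Subgroup Γ)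
    (hint : (E : Set Γ) ∩ (Dt : Set Γ) = {1})
    (hsupp : ∀ g : Γ, ∃ x ∈ E, ∃ d ∈ Dt, g = x * d)
    (D : Set Γ) (hD1 : (1 : Γ) ∈ D) (hDsub : D ⊆ (Dt : Set Γ))
    (pmul : Γ → Γ → Γ)
    (hpmul : ∀ x ∈ E, ∀ d ∈ D, ∀ y ∈ E, ∀ d' ∈ D, pmul (x * d) (y * d') = x * y) :
    ∃ (mul : Quot (simRel E D) → Quot (simRel E D) → Quot (simRel E D))
      (one : Quot (simRel E D)) (inv : Quot (simRel E D) → Quot (simRel E D)),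
      -- the operation is `[a]*[b] = [a.b]` (in particular it is well defined)
      (∀ (a b : ↥(prodSet E D)) (hab : pmul (a : Γ) (b : Γ) ∈ prodSet E D),
        mul (Quot.mk _ a) (Quot.mk _ b) = Quot.mk _ ⟨pmul (a : Γ) (b : Γ), hab⟩) ∧
      -- it makes `X` a group
      (∀ p q r : Quot (simRel E D), mul (mul p q) r = mul p (mul q r)) ∧
      (∀ p, mul one p = p) ∧ (∀ p, mul p one = p) ∧
      (∀ p, mul (inv p) p = one) ∧ (∀ p, mul p (inv p) = one) ∧
      -- the map `E → X`, `x ↦ [x]`, is a group isomorphism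
      ∃ ι : E → Quot (simRel E D),
        (∀ x : E, ι x = Quot.mk _ ⟨(x : Γ), ⟨(x : Γ), x.2, 1, hD1, (mul_one _).symm⟩⟩) ∧
        Function.Bijective ι ∧ ∀ x y : E, ι (x * y) = mul (ι x) (ι y) := by
  let e : E ≃ Quot (simRel E D) := Equiv.ofBijective _ (classMap_bijective hint hD1 hDsub)
  refine ⟨fun p q => e (e.symm p * e.symm q), e 1, fun p => e (e.symm p)⁻¹,
    ?_, ?_, ?_, ?_, ?_, ?_, e, fun _ => rfl, e.bijective, ?_⟩
  · rintro ⟨_, x, hx, d, hd, rfl⟩ ⟨_, y, hy, d', hd', rfl⟩ hab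
    have hmk : ∀ (a : ↥(prodSet E D)) (z : E), (z : Γ)⁻¹ * a ∈ D → Quot.mk _ a = e z :=
      mk_eq_classMap hD1
    rw [hmk _ ⟨x, hx⟩ (by simpa using hd), hmk _ ⟨y, hy⟩ (by simpa using hd'),
      hmk _ (⟨x, hx⟩ * ⟨y, hy⟩) (by simpa [hpmul x hx d hd y hy d' hd'] using hD1)]
    simp only [Equiv.symm_apply_apply]
  all_goals simp [mul_assoc]

end PartialGroup
end

section
/- Let H be a partial subgroup of G = E·D with support F = E ∩ H. The relation on G defined by a ~_r b if and only if b.a* ∈ F for some a* ∈ Inv(a) is an equivalence relation on G. -/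
namespace PartialGroup

variable {Γ : Type*} [Group Γ]

/-- For `a = x*d ∈ G` (unique decomposition, `x ∈ E`, `d ∈ D`),
`Inv(a) = {x⁻¹*d' : d' ∈ D}`. -/
def invSet (E : Subgroup Γ) (D : Set Γ) (a : Γ) : Set Γ :=
  {g | ∃ x ∈ E, ∃ d ∈ D, a = x * d ∧ ∃ d' ∈ D, g = x⁻¹ * d'}

/-- `H` is a partial subgroup of the partial group `G = E·D` with partial law `pmul`. -/
def IsPartialSubgroup (E : Subgroup Γ) (D : Set Γ) (pmul : Γ → Γ → Γ) (H : Set Γ) : Prop :=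
  H ⊆ prodSet E D ∧ (1 : Γ) ∈ H ∧ (∀ a ∈ H, ∀ b ∈ H, pmul a b ∈ H) ∧
    ∀ a ∈ H, (invSet E D a ∩ H).Nonempty

/-- The `E`-component of an element of `E·D` is determined by the element, because it is the
product with `1`. -/
lemma left_unique {E : Subgroup Γ} {D : Set Γ} (hD1 : (1 : Γ) ∈ D) {pmul : Γ → Γ → Γ}
    (hpmul : ∀ x ∈ E, ∀ d ∈ D, ∀ y ∈ E, ∀ d' ∈ D, pmul (x * d) (y * d') = x * y)
    {x y d d' : Γ} (hx : x ∈ E) (hy : y ∈ E) (hd : d ∈ D) (hd' : d' ∈ D)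
    (h : x * d = y * d') : x = y := by
  have h₁ := hpmul x hx d hd 1 E.one_mem 1 hD1
  have h₂ := hpmul y hy d' hd' 1 E.one_mem 1 hD1
  rw [h, h₂] at h₁
  simpa using h₁.symm

/-- The support `E ∩ H` of a partial subgroup, as a subgroup of `Γ`. -/
def support {E : Subgroup Γ} {D : Set Γ} (hD1 : (1 : Γ) ∈ D) {pmul : Γ → Γ → Γ}
    (hpmul : ∀ x ∈ E, ∀ d ∈ D, ∀ y ∈ E, ∀ d' ∈ D, pmul (x * d) (y * d') = x * y)
    {H : Set Γ} (hH : IsPartialSubgroup E D pmul H) : Subgroup Γ where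
  carrier := (E : Set Γ) ∩ H
  one_mem' := ⟨E.one_mem, hH.2.1⟩
  mul_mem' := by
    rintro u v ⟨hu, huH⟩ ⟨hv, hvH⟩
    have h := hH.2.2.1 u huH v hvH
    have huv := hpmul u hu 1 hD1 v hv 1 hD1
    rw [mul_one, mul_one] at huv
    exact ⟨E.mul_mem hu hv, huv ▸ h⟩
  inv_mem' := by
    rintro u ⟨hu, huH⟩
    obtain ⟨_, ⟨x, hx, d, hd, hux, d', hd', rfl⟩, hgH⟩ := hH.2.2.2 u huH
    obtain rfl : u = x := left_unique hD1 hpmul hu hx hD1 hd (by rw [mul_one, hux])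
    have h := hH.2.2.1 _ hgH 1 hH.2.1
    have hinv := hpmul u⁻¹ (E.inv_mem hu) d' hd' 1 E.one_mem 1 hD1
    rw [mul_one, mul_one] at hinv
    exact ⟨E.inv_mem hu, hinv ▸ h⟩

/-- In terms of `E`-components, the relation `~ᵣ` is the right coset relation of the support. -/
lemma exists_invSet_pmul_mem_iff {E : Subgroup Γ} {D : Set Γ} (hD1 : (1 : Γ) ∈ D)
    {pmul : Γ → Γ → Γ}
    (hpmul : ∀ x ∈ E, ∀ d ∈ D, ∀ y ∈ E, ∀ d' ∈ D, pmul (x * d) (y * d') = x * y)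
    {S : Set Γ} {x d y d' : Γ} (hx : x ∈ E) (hd : d ∈ D) (hy : y ∈ E) (hd' : d' ∈ D) :
    (∃ as ∈ invSet E D (x * d), pmul (y * d') as ∈ S) ↔ y * x⁻¹ ∈ S := by
  constructor
  · rintro ⟨_, ⟨z, hz, c, hc, hxz, c', hc', rfl⟩, h⟩
    obtain rfl : x = z := left_unique hD1 hpmul hx hz hd hc hxz
    rwa [hpmul y hy d' hd' x⁻¹ (E.inv_mem hx) c' hc'] at h
  · intro h
    refine ⟨x⁻¹ * 1, ⟨x, hx, d, hd, rfl, 1, hD1, rfl⟩, ?_⟩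
    rwa [hpmul y hy d' hd' x⁻¹ (E.inv_mem hx) 1 hD1]

/-- Let `H` be a partial subgroup of `G = E·D` with support `F = E ∩ H`.
The relation on `G` defined by `a ~ᵣ b` iff `b.a* ∈ F` for some `a* ∈ Inv(a)` is an
equivalence relation on `G`. -/
theorem rightCosetRel_equivalence
    (E Dt : Subgroup Γ)
    (hint : (E : Set Γ) ∩ (Dt : Set Γ) = {1})
    (hsupp : ∀ g : Γ, ∃ x ∈ E, ∃ d ∈ Dt, g = x * d)
    (D : Set Γ) (hD1 : (1 : Γ) ∈ D) (hDsub : D ⊆ (Dt : Set Γ))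
    (pmul : Γ → Γ → Γ)
    (hpmul : ∀ x ∈ E, ∀ d ∈ D, ∀ y ∈ E, ∀ d' ∈ D, pmul (x * d) (y * d') = x * y)
    (H : Set Γ) (hH : IsPartialSubgroup E D pmul H) :
    Equivalence (fun a b : ↥(prodSet E D) =>
      ∃ as ∈ invSet E D (a : Γ), pmul (b : Γ) as ∈ (E : Set Γ) ∩ H) := by
  have key {x d y d' : Γ} (hx : x ∈ E) (hd : d ∈ D) (hy : y ∈ E) (hd' : d' ∈ D) :
      (∃ as ∈ invSet E D (x * d), pmul (y * d') as ∈ (E : Set Γ) ∩ H) ↔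
        y * x⁻¹ ∈ support hD1 hpmul hH :=
    exists_invSet_pmul_mem_iff hD1 hpmul hx hd hy hd'
  constructor
  · rintro ⟨_, x, hx, d, hd, rfl⟩
    rw [key hx hd hx hd, mul_inv_cancel]
    exact one_mem _
  · rintro ⟨_, x, hx, d, hd, rfl⟩ ⟨_, y, hy, d', hd', rfl⟩ h
    rw [key hx hd hy hd'] at h
    rw [key hy hd' hx hd]
    simpa using inv_mem h
  · rintro ⟨_, x, hx, d, hd, rfl⟩ ⟨_, y, hy, d', hd', rfl⟩ ⟨_, z, hz, d'', hd'', rfl⟩ h₁ h₂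
    rw [key hx hd hy hd'] at h₁
    rw [key hy hd' hz hd''] at h₂
    rw [key hx hd hz hd'']
    simpa using mul_mem h₂ h₁

end PartialGroup
end

section
/- Let H be a partial subgroup of G = E·D with support F = E ∩ H. For a, b ∈ G the following are equivalent: (i) a ~_H b; (ii) a*.b ∈ F for every a* ∈ Inv(a); (iii) b.e = a.h for some h ∈ H; (iv) b.e ∈ aH; (v) bH ⊆ aH; (vi) bH = aH. -/
namespace PartialGroup

variable {Γ : Type*} [Group Γ]

/-- The left coset `aH = {a.h : h ∈ H}` for the partial law `pmul`. -/
def lcoset (pmul : Γ → Γ → Γ) (a : Γ) (H : Set Γ) : Set Γ :=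
  {g | ∃ h ∈ H, g = pmul a h}

theorem pmul_eq_mul {E : Subgroup Γ} {D : Set Γ} (hD1 : (1 : Γ) ∈ D) {pmul : Γ → Γ → Γ}
    (hpmul : ∀ x ∈ E, ∀ d ∈ D, ∀ y ∈ E, ∀ d' ∈ D, pmul (x * d) (y * d') = x * y)
    {x d y : Γ} (hx : x ∈ E) (hd : d ∈ D) (hy : y ∈ E) : pmul (x * d) y = x * y := by
  simpa using hpmul x hx d hd y hy 1 hD1

/-- The `E`-component of an element of `E·D` is determined by that element. -/
theorem left_component_unique {E : Subgroup Γ} {D : Set Γ} (hD1 : (1 : Γ) ∈ D)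
    {pmul : Γ → Γ → Γ}
    (hpmul : ∀ x ∈ E, ∀ d ∈ D, ∀ y ∈ E, ∀ d' ∈ D, pmul (x * d) (y * d') = x * y)
    {x d y d' : Γ} (hx : x ∈ E) (hd : d ∈ D) (hy : y ∈ E) (hd' : d' ∈ D)
    (h : x * d = y * d') : x = y := by
  have hxe := pmul_eq_mul hD1 hpmul hx hd E.one_mem
  rw [h, pmul_eq_mul hD1 hpmul hy hd' E.one_mem, mul_one, mul_one] at hxe
  exact hxe.symm

/-- The `E`-component of an element of a partial subgroup `H` lies in `H`. -/
theorem left_component_mem {E : Subgroup Γ} {D : Set Γ} (hD1 : (1 : Γ) ∈ D)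
    {pmul : Γ → Γ → Γ}
    (hpmul : ∀ x ∈ E, ∀ d ∈ D, ∀ y ∈ E, ∀ d' ∈ D, pmul (x * d) (y * d') = x * y)
    {H : Set Γ} (hH : IsPartialSubgroup E D pmul H)
    {x d : Γ} (hx : x ∈ E) (hd : d ∈ D) (h : x * d ∈ H) : x ∈ H := by
  simpa [pmul_eq_mul hD1 hpmul hx hd E.one_mem] using hH.2.2.1 _ h 1 hH.2.1

/-- The support `E ∩ H` of a partial subgroup `H`, as a subgroup of `Γ`. -/
def supportSubgroup {E : Subgroup Γ} {D : Set Γ} (hD1 : (1 : Γ) ∈ D)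
    {pmul : Γ → Γ → Γ}
    (hpmul : ∀ x ∈ E, ∀ d ∈ D, ∀ y ∈ E, ∀ d' ∈ D, pmul (x * d) (y * d') = x * y)
    {H : Set Γ} (hH : IsPartialSubgroup E D pmul H) : Subgroup Γ where
  carrier := (E : Set Γ) ∩ H
  one_mem' := ⟨E.one_mem, hH.2.1⟩
  mul_mem' := by
    rintro x y ⟨hxE, hxH⟩ ⟨hyE, hyH⟩
    refine ⟨E.mul_mem hxE hyE, ?_⟩
    have hxy := pmul_eq_mul hD1 hpmul hxE hD1 hyE
    rw [mul_one] at hxy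
    exact hxy ▸ hH.2.2.1 x hxH y hyH
  inv_mem' := by
    rintro x ⟨hxE, hxH⟩
    refine ⟨E.inv_mem hxE, ?_⟩
    obtain ⟨_, ⟨y, hy, d, hd, hxy, d', hd', rfl⟩, hinv⟩ := hH.2.2.2 x hxH
    obtain rfl : x = y :=
      left_component_unique hD1 hpmul hxE hD1 hy hd (by rwa [mul_one])
    exact left_component_mem hD1 hpmul hH (E.inv_mem hxE) hd' hinv

/-- The coset of `x*d` modulo `H` is the coset of `x` modulo the support of `H`. -/
theorem mem_lcoset_iff {E : Subgroup Γ} {D : Set Γ} (hD1 : (1 : Γ) ∈ D)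
    {pmul : Γ → Γ → Γ}
    (hpmul : ∀ x ∈ E, ∀ d ∈ D, ∀ y ∈ E, ∀ d' ∈ D, pmul (x * d) (y * d') = x * y)
    {H : Set Γ} (hH : IsPartialSubgroup E D pmul H)
    {x d g : Γ} (hx : x ∈ E) (hd : d ∈ D) :
    g ∈ lcoset pmul (x * d) H ↔ x⁻¹ * g ∈ supportSubgroup hD1 hpmul hH := by
  constructor
  · rintro ⟨h, hh, rfl⟩
    obtain ⟨y, hy, d', hd', rfl⟩ := hH.1 hh
    rw [hpmul x hx d hd y hy d' hd', inv_mul_cancel_left]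
    exact ⟨hy, left_component_mem hD1 hpmul hH hy hd' hh⟩
  · rintro ⟨hgE, hgH⟩
    exact ⟨_, hgH, by rw [pmul_eq_mul hD1 hpmul hx hd hgE, mul_inv_cancel_left]⟩

/-- Let `H` be a partial subgroup of `G = E·D` with support `F = E ∩ H`.
For `a, b ∈ G` the following are equivalent:
(i) `a ~_H b` (i.e. `a.e = b.h` for some `h ∈ H`);
(ii) `a*.b ∈ F` for every `a* ∈ Inv(a)`;
(iii) `b.e = a.h` for some `h ∈ H`;
(iv) `b.e ∈ aH`; (v) `bH ⊆ aH`; (vi) `bH = aH`. -/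
theorem congruence_mod_H_tfae
    (E Dt : Subgroup Γ)
    (hint : (E : Set Γ) ∩ (Dt : Set Γ) = {1})
    (hsupp : ∀ g : Γ, ∃ x ∈ E, ∃ d ∈ Dt, g = x * d)
    (D : Set Γ) (hD1 : (1 : Γ) ∈ D) (hDsub : D ⊆ (Dt : Set Γ))
    (pmul : Γ → Γ → Γ)
    (hpmul : ∀ x ∈ E, ∀ d ∈ D, ∀ y ∈ E, ∀ d' ∈ D, pmul (x * d) (y * d') = x * y)
    (H : Set Γ) (hH : IsPartialSubgroup E D pmul H) :
    ∀ a ∈ prodSet E D, ∀ b ∈ prodSet E D,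
      [(∃ h ∈ H, pmul a 1 = pmul b h),
       (∀ as ∈ invSet E D a, pmul as b ∈ (E : Set Γ) ∩ H),
       (∃ h ∈ H, pmul b 1 = pmul a h),
       pmul b 1 ∈ lcoset pmul a H,
       lcoset pmul b H ⊆ lcoset pmul a H,
       lcoset pmul b H = lcoset pmul a H].TFAE := by
  rintro _ ⟨x, hx, d, hd, rfl⟩ _ ⟨y, hy, d', hd', rfl⟩
  set F := supportSubgroup hD1 hpmul hH
  have mem_x : ∀ g, g ∈ lcoset pmul (x * d) H ↔ x⁻¹ * g ∈ F := fun g =>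
    mem_lcoset_iff hD1 hpmul hH hx hd
  have mem_y : ∀ g, g ∈ lcoset pmul (y * d') H ↔ y⁻¹ * g ∈ F := fun g =>
    mem_lcoset_iff hD1 hpmul hH hy hd'
  have hx1 : pmul (x * d) 1 = x := by
    rw [pmul_eq_mul hD1 hpmul hx hd E.one_mem, mul_one]
  have hy1 : pmul (y * d') 1 = y := by
    rw [pmul_eq_mul hD1 hpmul hy hd' E.one_mem, mul_one]
  rw [hx1, hy1]
  tfae_have 1 ↔ 4 := by
    change x ∈ lcoset pmul (y * d') H ↔ _
    rw [mem_x, mem_y, ← F.inv_mem_iff, mul_inv_rev, inv_inv]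
  tfae_have 2 ↔ 4 := by
    rw [mem_x]
    constructor
    · intro h
      have hxy := h (x⁻¹ * 1) ⟨x, hx, d, hd, rfl, 1, hD1, rfl⟩
      rwa [hpmul _ (E.inv_mem hx) _ hD1 y hy d' hd'] at hxy
    · rintro h _ ⟨z, hz, c, hc, hxz, c', hc', rfl⟩
      obtain rfl := left_component_unique hD1 hpmul hx hd hz hc hxz
      rw [hpmul _ (E.inv_mem hx) c' hc' y hy d' hd']
      exact h
  tfae_have 3 ↔ 4 := Iff.rfl
  tfae_have 4 → 6 := by
    intro h
    rw [mem_x] at h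
    ext g
    rw [mem_x, mem_y, ← F.mul_mem_cancel_left h, mul_assoc, mul_inv_cancel_left]
  tfae_have 6 → 5 := fun h => h.subset
  tfae_have 5 → 4 := fun h => h ((mem_y y).2 (by simp [F.one_mem]))
  tfae_finish

end PartialGroup
end

section
/- Let f : G₁ → G₂ be a partial group homomorphism. Then the default kernel K̃ := f⁻¹(D₂) = {a ∈ G₁ : f(a) ∈ D₂} is a normal partial subgroup of G₁: it contains e₁, is closed under the partial law, satisfies Inv(a) ⊆ K̃ for all a ∈ K̃, and aK̃ = K̃a for all a ∈ G₁. -/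
namespace PartialGroup

variable {Γ : Type*} [Group Γ]

/-- The right coset `Ha = {h.a : h ∈ H}` for the partial law `pmul`. -/
def rcoset (pmul : Γ → Γ → Γ) (a : Γ) (H : Set Γ) : Set Γ :=
  {g | ∃ h ∈ H, g = pmul h a}

/-- Let `f : G₁ → G₂` be a partial group homomorphism. Then the default
kernel `K̃ := f⁻¹(D₂) = {a ∈ G₁ : f(a) ∈ D₂}` is a normal partial subgroup of `G₁`:
it contains `e₁`, is closed under the partial law, satisfies `Inv(a) ⊆ K̃` for all `a ∈ K̃`,
and `aK̃ = K̃a` for all `a ∈ G₁`. -/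
theorem default_kernel_normal
    {Γ₁ Γ₂ : Type*} [Group Γ₁] [Group Γ₂]
    (E₁ Dt₁ : Subgroup Γ₁)
    (hint₁ : (E₁ : Set Γ₁) ∩ (Dt₁ : Set Γ₁) = {1})
    (hsupp₁ : ∀ g : Γ₁, ∃ x ∈ E₁, ∃ d ∈ Dt₁, g = x * d)
    (D₁ : Set Γ₁) (hD₁1 : (1 : Γ₁) ∈ D₁) (hD₁sub : D₁ ⊆ (Dt₁ : Set Γ₁))
    (pmul₁ : Γ₁ → Γ₁ → Γ₁)
    (hpmul₁ : ∀ x ∈ E₁, ∀ d ∈ D₁, ∀ y ∈ E₁, ∀ d' ∈ D₁, pmul₁ (x * d) (y * d') = x * y)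
    (E₂ Dt₂ : Subgroup Γ₂)
    (hint₂ : (E₂ : Set Γ₂) ∩ (Dt₂ : Set Γ₂) = {1})
    (hsupp₂ : ∀ g : Γ₂, ∃ x ∈ E₂, ∃ d ∈ Dt₂, g = x * d)
    (D₂ : Set Γ₂) (hD₂1 : (1 : Γ₂) ∈ D₂) (hD₂sub : D₂ ⊆ (Dt₂ : Set Γ₂))
    (pmul₂ : Γ₂ → Γ₂ → Γ₂)
    (hpmul₂ : ∀ x ∈ E₂, ∀ d ∈ D₂, ∀ y ∈ E₂, ∀ d' ∈ D₂, pmul₂ (x * d) (y * d') = x * y)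
    (f : Γ₁ → Γ₂)
    (hfG : ∀ a ∈ prodSet E₁ D₁, f a ∈ prodSet E₂ D₂)
    (hfE : ∀ x ∈ (E₁ : Set Γ₁), f x ∈ E₂)
    (hfD : ∀ d ∈ D₁, f d ∈ D₂)
    (hfhom : ∀ a ∈ prodSet E₁ D₁, ∀ b ∈ prodSet E₁ D₁,
      pmul₂ (f (pmul₁ a b)) 1 = pmul₂ (f a) (f b)) :
    (1 : Γ₁) ∈ prodSet E₁ D₁ ∩ f ⁻¹' D₂ ∧
    (∀ a ∈ prodSet E₁ D₁ ∩ f ⁻¹' D₂, ∀ b ∈ prodSet E₁ D₁ ∩ f ⁻¹' D₂,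
      pmul₁ a b ∈ prodSet E₁ D₁ ∩ f ⁻¹' D₂) ∧
    (∀ a ∈ prodSet E₁ D₁ ∩ f ⁻¹' D₂, invSet E₁ D₁ a ⊆ prodSet E₁ D₁ ∩ f ⁻¹' D₂) ∧
    (∀ a ∈ prodSet E₁ D₁,
      lcoset pmul₁ a (prodSet E₁ D₁ ∩ f ⁻¹' D₂) = rcoset pmul₁ a (prodSet E₁ D₁ ∩ f ⁻¹' D₂)) := by
  have f_one : f 1 = 1 := by
    have h : f 1 ∈ (E₂ : Set Γ₂) ∩ (Dt₂ : Set Γ₂) :=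
      ⟨hfE 1 E₁.one_mem, hD₂sub (hfD 1 hD₁1)⟩
    rwa [hint₂] at h
  have mem_prod : ∀ x ∈ E₁, ∀ d ∈ D₁, x * d ∈ prodSet E₁ D₁ :=
    fun x hx d hd => ⟨x, hx, d, hd, rfl⟩
  have mem_prod_one : ∀ x ∈ E₁, x ∈ prodSet E₁ D₁ :=
    fun x hx => ⟨x, hx, 1, hD₁1, (mul_one x).symm⟩
  have pmul₂_support : ∀ x ∈ E₂, ∀ y ∈ E₂, pmul₂ x y = x * y := fun x hx y hy => by
    simpa using hpmul₂ x hx 1 hD₂1 y hy 1 hD₂1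
  have f_mul : ∀ x ∈ E₁, ∀ y ∈ E₁, f (x * y) = f x * f y := fun x hx y hy => by
    have h := hfhom x (mem_prod_one x hx) y (mem_prod_one y hy)
    have hxy : pmul₁ x y = x * y := by simpa using hpmul₁ x hx 1 hD₁1 y hy 1 hD₁1
    rwa [hxy, pmul₂_support _ (hfE _ (E₁.mul_mem hx hy)) 1 E₂.one_mem, mul_one,
      pmul₂_support _ (hfE x hx) _ (hfE y hy)] at h
  have f_inv : ∀ x ∈ E₁, f x⁻¹ = (f x)⁻¹ := fun x hx => by
    rw [eq_inv_iff_mul_eq_one, ← f_mul _ (E₁.inv_mem hx) x hx, inv_mul_cancel, f_one]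
  -- The support component of `f (x * d)` is `f x`.
  have f_decomp : ∀ x ∈ E₁, ∀ d ∈ D₁, ∃ v ∈ D₂, f (x * d) = f x * v := fun x hx d hd => by
    obtain ⟨u, hu, v, hv, huv⟩ := hfG _ (mem_prod x hx d hd)
    have h := hfhom _ (mem_prod x hx d hd) 1 (mem_prod_one 1 E₁.one_mem)
    have hx1 : pmul₁ (x * d) 1 = x := by
      simpa using hpmul₁ x hx d hd 1 E₁.one_mem 1 hD₁1
    have hu1 : pmul₂ (u * v) 1 = u := by
      simpa using hpmul₂ u hu v hv 1 E₂.one_mem 1 hD₂1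
    rw [hx1, pmul₂_support _ (hfE x hx) 1 E₂.one_mem, mul_one, f_one, huv, hu1] at h
    exact ⟨v, hv, by rw [h, huv]⟩
  have mem_ker : ∀ x ∈ E₁, ∀ d ∈ D₁,
      (x * d ∈ prodSet E₁ D₁ ∩ f ⁻¹' D₂ ↔ f x = 1) := fun x hx d hd => by
    obtain ⟨v, hv, hfv⟩ := f_decomp x hx d hd
    constructor
    · rintro ⟨-, h⟩
      rw [Set.mem_preimage, hfv] at h
      have hmem : f x ∈ (E₂ : Set Γ₂) ∩ (Dt₂ : Set Γ₂) :=
        ⟨hfE x hx, (Dt₂.mul_mem_cancel_right (hD₂sub hv)).1 (hD₂sub h)⟩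
      rwa [hint₂] at hmem
    · intro h
      refine ⟨mem_prod x hx d hd, ?_⟩
      rwa [Set.mem_preimage, hfv, h, one_mul]
  have mem_ker_support : ∀ x ∈ E₁, f x = 1 → x ∈ prodSet E₁ D₁ ∩ f ⁻¹' D₂ :=
    fun x hx h => by simpa using (mem_ker x hx 1 hD₁1).2 h
  have conj_mem_ker : ∀ x ∈ E₁, ∀ y ∈ E₁, f y = 1 → f (x * y * x⁻¹) = 1 :=
    fun x hx y hy h => by
      rw [f_mul _ (E₁.mul_mem hx hy) _ (E₁.inv_mem hx), f_mul x hx y hy, f_inv x hx, h, mul_one,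
        mul_inv_cancel]
  refine ⟨mem_ker_support 1 E₁.one_mem f_one, ?_, ?_, ?_⟩
  · rintro a ha b hb
    obtain ⟨x, hx, d, hd, rfl⟩ := ha.1
    obtain ⟨y, hy, d', hd', rfl⟩ := hb.1
    rw [mem_ker x hx d hd] at ha
    rw [mem_ker y hy d' hd'] at hb
    rw [hpmul₁ x hx d hd y hy d' hd']
    exact mem_ker_support _ (E₁.mul_mem hx hy) (by rw [f_mul x hx y hy, ha, hb, mul_one])
  · rintro a ha _ ⟨x, hx, d, hd, rfl, d', hd', rfl⟩
    rw [mem_ker x hx d hd] at ha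
    rw [mem_ker _ (E₁.inv_mem hx) d' hd', f_inv x hx, ha, inv_one]
  · rintro _ ⟨x, hx, d, hd, rfl⟩
    ext g
    constructor
    · rintro ⟨h, hh, rfl⟩
      obtain ⟨y, hy, d', hd', rfl⟩ := hh.1
      rw [mem_ker y hy d' hd'] at hh
      have hc : x * y * x⁻¹ ∈ E₁ := E₁.mul_mem (E₁.mul_mem hx hy) (E₁.inv_mem hx)
      refine ⟨x * y * x⁻¹, mem_ker_support _ hc (conj_mem_ker x hx y hy hh), ?_⟩
      have h := hpmul₁ _ hc 1 hD₁1 x hx d hd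
      rw [mul_one, inv_mul_cancel_right] at h
      rw [h, hpmul₁ x hx d hd y hy d' hd']
    · rintro ⟨h, hh, rfl⟩
      obtain ⟨y, hy, d', hd', rfl⟩ := hh.1
      rw [mem_ker y hy d' hd'] at hh
      have hc : x⁻¹ * y * x ∈ E₁ := E₁.mul_mem (E₁.mul_mem (E₁.inv_mem hx) hy) hx
      have hfc : f (x⁻¹ * y * x) = 1 := by
        simpa using conj_mem_ker x⁻¹ (E₁.inv_mem hx) y hy hh
      refine ⟨x⁻¹ * y * x, mem_ker_support _ hc hfc, ?_⟩
      have h := hpmul₁ x hx d hd _ hc 1 hD₁1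
      rw [mul_one, mul_assoc x⁻¹, mul_inv_cancel_left] at h
      rw [mul_assoc x⁻¹, h, hpmul₁ y hy d' hd' x hx d hd]

end PartialGroup
end

section
/- (First isomorphism theorem for partial groups) Let f : G₁ → G₂ be a partial group homomorphism and let K = f⁻¹(D₂) be its default kernel, a normal partial subgroup of G₁. Then the map sending the ~_K-class of a ∈ G₁ to f(a).e₂ = f(a.e₁) is a well-defined bijection from the quotient G₁/~_K onto f(E₁) (the support of the partial subgroup Im(f) of G₂), and it is multiplicative: the class of a.b is sent to (f(a).e₂)*(f(b).e₂). -/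
namespace PartialGroup

variable {Γ : Type*} [Group Γ]

/-- The congruence `a ~_N b` iff `a.e = b.h` for some `h ∈ N`, as a relation on
(the subtype of) the carrier set `S` of the partial group. -/
def simRelN (pmul : Γ → Γ → Γ) (N : Set Γ) (S : Set Γ) (a b : ↥S) : Prop :=
  ∃ h ∈ N, pmul (a : Γ) 1 = pmul (b : Γ) h

/-- **First isomorphism theorem for partial groups.**
Let `f : G₁ → G₂` be a partial group homomorphism and `K = f⁻¹(D₂)` its default kernel
(a normal partial subgroup of `G₁`). Then the map sending the `~_K`-class of `a ∈ G₁` to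
`f(a).e₂ = f(a.e₁)` is a well-defined bijection from `G₁/~_K` onto `f(E₁)` (the support of
the partial subgroup `Im(f)` of `G₂`), and it is multiplicative: the class of `a.b` is sent
to `(f(a).e₂)*(f(b).e₂)`. -/
theorem first_isomorphism
    {Γ₁ Γ₂ : Type*} [Group Γ₁] [Group Γ₂]
    (E₁ Dt₁ : Subgroup Γ₁)
    (hint₁ : (E₁ : Set Γ₁) ∩ (Dt₁ : Set Γ₁) = {1})
    (hsupp₁ : ∀ g : Γ₁, ∃ x ∈ E₁, ∃ d ∈ Dt₁, g = x * d)
    (D₁ : Set Γ₁) (hD₁1 : (1 : Γ₁) ∈ D₁) (hD₁sub : D₁ ⊆ (Dt₁ : Set Γ₁))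
    (pmul₁ : Γ₁ → Γ₁ → Γ₁)
    (hpmul₁ : ∀ x ∈ E₁, ∀ d ∈ D₁, ∀ y ∈ E₁, ∀ d' ∈ D₁, pmul₁ (x * d) (y * d') = x * y)
    (E₂ Dt₂ : Subgroup Γ₂)
    (hint₂ : (E₂ : Set Γ₂) ∩ (Dt₂ : Set Γ₂) = {1})
    (hsupp₂ : ∀ g : Γ₂, ∃ x ∈ E₂, ∃ d ∈ Dt₂, g = x * d)
    (D₂ : Set Γ₂) (hD₂1 : (1 : Γ₂) ∈ D₂) (hD₂sub : D₂ ⊆ (Dt₂ : Set Γ₂))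
    (pmul₂ : Γ₂ → Γ₂ → Γ₂)
    (hpmul₂ : ∀ x ∈ E₂, ∀ d ∈ D₂, ∀ y ∈ E₂, ∀ d' ∈ D₂, pmul₂ (x * d) (y * d') = x * y)
    (f : Γ₁ → Γ₂)
    (hfG : ∀ a ∈ prodSet E₁ D₁, f a ∈ prodSet E₂ D₂)
    (hfE : ∀ x ∈ (E₁ : Set Γ₁), f x ∈ E₂)
    (hfD : ∀ d ∈ D₁, f d ∈ D₂)
    (hfhom : ∀ a ∈ prodSet E₁ D₁, ∀ b ∈ prodSet E₁ D₁,
      pmul₂ (f (pmul₁ a b)) 1 = pmul₂ (f a) (f b)) :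
    -- `f(a).e₂ = f(a.e₁)` for every `a ∈ G₁`
    (∀ a ∈ prodSet E₁ D₁, pmul₂ (f a) 1 = f (pmul₁ a 1)) ∧
    -- the induced map on `G₁/~_K`, where `K = f⁻¹(D₂)` is the default kernel
    ∃ φ : Quot (simRelN pmul₁ (prodSet E₁ D₁ ∩ f ⁻¹' D₂) (prodSet E₁ D₁)) → Γ₂,
      -- well defined, sending the class of `a` to `f(a).e₂`
      (∀ a : ↥(prodSet E₁ D₁), φ (Quot.mk _ a) = pmul₂ (f (a : Γ₁)) 1) ∧
      -- a bijection onto `f(E₁)`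
      Function.Injective φ ∧
      Set.range φ = f '' (E₁ : Set Γ₁) ∧
      -- multiplicative: the class of `a.b` is sent to `(f(a).e₂)*(f(b).e₂)`
      (∀ (a b : ↥(prodSet E₁ D₁)) (hab : pmul₁ (a : Γ₁) (b : Γ₁) ∈ prodSet E₁ D₁),
        φ (Quot.mk _ ⟨pmul₁ (a : Γ₁) (b : Γ₁), hab⟩) =
          pmul₂ (f (a : Γ₁)) 1 * pmul₂ (f (b : Γ₁)) 1) := by
  have f_one : f 1 = 1 := by
    have h : f 1 ∈ (E₂ : Set Γ₂) ∩ (Dt₂ : Set Γ₂) := ⟨hfE 1 E₁.one_mem, hD₂sub (hfD 1 hD₁1)⟩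
    rwa [hint₂] at h
  have mem_of_mem_E : ∀ x ∈ E₁, x ∈ prodSet E₁ D₁ := fun x hx => ⟨x, hx, 1, hD₁1, by simp⟩
  have pmul₁_one : ∀ x ∈ E₁, ∀ d ∈ D₁, pmul₁ (x * d) 1 = x := fun x hx d hd => by
    simpa using hpmul₁ x hx d hd 1 E₁.one_mem 1 hD₁1
  have pmul₁_E : ∀ x ∈ E₁, ∀ y ∈ E₁, pmul₁ x y = x * y := fun x hx y hy => by
    simpa using hpmul₁ x hx 1 hD₁1 y hy 1 hD₁1
  have pmul₂_E : ∀ x ∈ E₂, ∀ y ∈ E₂, pmul₂ x y = x * y := fun x hx y hy => by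
    simpa using hpmul₂ x hx 1 hD₂1 y hy 1 hD₂1
  have pmul₂_E_one : ∀ x ∈ E₂, pmul₂ x 1 = x := fun x hx => by
    simpa using pmul₂_E x hx 1 E₂.one_mem
  have pmul₂_D_one : ∀ d ∈ D₂, pmul₂ d 1 = 1 := fun d hd => by
    simpa using hpmul₂ 1 E₂.one_mem d hd 1 E₂.one_mem 1 hD₂1
  have f_support : ∀ x ∈ E₁, ∀ d ∈ D₁, pmul₂ (f (x * d)) 1 = f x := fun x hx d hd => by
    have h := hfhom (x * d) ⟨x, hx, d, hd, rfl⟩ 1 (mem_of_mem_E 1 E₁.one_mem)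
    rw [pmul₁_one x hx d hd, f_one, pmul₂_E_one _ (hfE x hx)] at h
    exact h.symm
  have f_mul : ∀ x ∈ E₁, ∀ y ∈ E₁, f (x * y) = f x * f y := fun x hx y hy => by
    have h := hfhom x (mem_of_mem_E x hx) y (mem_of_mem_E y hy)
    rwa [pmul₁_E x hx y hy, pmul₂_E_one _ (hfE _ (E₁.mul_mem hx hy)),
      pmul₂_E _ (hfE x hx) _ (hfE y hy)] at h
  refine ⟨?_, Quot.lift (fun a => pmul₂ (f (a : Γ₁)) 1) ?_, fun _ => rfl, ?_, ?_, ?_⟩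
  · rintro _ ⟨x, hx, d, hd, rfl⟩
    rw [f_support x hx d hd, pmul₁_one x hx d hd]
  · rintro ⟨_, x, hx, d, hd, rfl⟩ ⟨_, y, hy, d', hd', rfl⟩ ⟨_, ⟨⟨z, hz, c, hc, rfl⟩, hK⟩, h⟩
    have hfz : f z = 1 := by rw [← f_support z hz c hc, pmul₂_D_one _ hK]
    change pmul₁ (x * d) 1 = pmul₁ (y * d') (z * c) at h
    rw [pmul₁_one x hx d hd, hpmul₁ y hy d' hd' z hz c hc] at h
    change pmul₂ (f (x * d)) 1 = pmul₂ (f (y * d')) 1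
    rw [f_support x hx d hd, f_support y hy d' hd', h, f_mul y hy z hz, hfz, mul_one]
  · rintro ⟨_, x, hx, d, hd, rfl⟩ ⟨_, y, hy, d', hd', rfl⟩ h
    change pmul₂ (f (x * d)) 1 = pmul₂ (f (y * d')) 1 at h
    rw [f_support x hx d hd, f_support y hy d' hd'] at h
    have hyx : y⁻¹ * x ∈ E₁ := E₁.mul_mem (E₁.inv_mem hy) hx
    have hf : f (y⁻¹ * x) = 1 := by
      have h' := f_mul y hy _ hyx
      rwa [mul_inv_cancel_left, h, left_eq_mul] at h'
    refine Quot.sound ⟨y⁻¹ * x, ⟨mem_of_mem_E _ hyx, ?_⟩, ?_⟩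
    · rw [Set.mem_preimage, hf]
      exact hD₂1
    · have h' := hpmul₁ y hy d' hd' _ hyx 1 hD₁1
      rw [mul_one, mul_inv_cancel_left] at h'
      exact (pmul₁_one x hx d hd).trans h'.symm
  · ext g
    constructor
    · rintro ⟨⟨_, x, hx, d, hd, rfl⟩, rfl⟩
      exact ⟨x, hx, (f_support x hx d hd).symm⟩
    · rintro ⟨x, hx, rfl⟩
      exact ⟨Quot.mk _ ⟨x, mem_of_mem_E x hx⟩, pmul₂_E_one _ (hfE x hx)⟩
  · rintro ⟨_, x, hx, d, hd, rfl⟩ ⟨_, y, hy, d', hd', rfl⟩ _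
    change pmul₂ (f (pmul₁ (x * d) (y * d'))) 1 = pmul₂ (f (x * d)) 1 * pmul₂ (f (y * d')) 1
    rw [hpmul₁ x hx d hd y hy d' hd', pmul₂_E_one _ (hfE _ (E₁.mul_mem hx hy)),
      f_support x hx d hd, f_support y hy d' hd', f_mul x hx y hy]

end PartialGroup
end
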